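/- Assume Hypothesis (H1), let β ≥ 0, and let y be a classical solution of the damped degenerate wave equation. Then for every T > s > 0, with Q_s = (s,T)×(0,1) and K as in Hypothesis (H1), one has ∫∫_{Q_s} (1 − x(a'−b)/a + K/2) (1/σ) y_t² dx dt + ∫∫_{Q_s} (1 − x b/a − K/2) η y_x² dx dt = (B.T.), where (B.T.) = ∫_0^1 [−2x y_x y_t/σ + (K/2) y y_t/σ]_{t=s}^{t=T} dx + ∫_s^T [y_t²/σ + η y_x² − (K/2) η y y_x](t,1) dt. -/

import Mathlib

open MeasureTheory Set Filter Topology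

/-- The Feller weight `η(x) = exp (∫_{1/2}^x b/a)`. -/
noncomputable def etaW (a b : ℝ → ℝ) (x : ℝ) : ℝ :=
  Real.exp (∫ s in (1/2 : ℝ)..x, b s / a s)

/-- The weight `σ = a / η`. -/
noncomputable def sigW (a b : ℝ → ℝ) (x : ℝ) : ℝ :=
  a x / etaW a b x

/-- `u ∈ H¹(0,1)` with (a.e.) derivative `u'`. -/
structure MemH1 (u u' : ℝ → ℝ) : Prop where
  cont : ContinuousOn u (Set.Icc 0 1)
  hasDeriv : ∀ᵐ x ∂(volume.restrict (Set.Ioo (0:ℝ) 1)), HasDerivAt u (u' x) x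
  deriv_sq_int : IntegrableOn (fun x => (u' x) ^ 2) (Set.Ioo (0:ℝ) 1)
  ftc : ∀ x ∈ Set.Icc (0:ℝ) 1, u x = u 0 + ∫ t in Set.Ioo (0:ℝ) x, u' t

/-- `u ∈ L²_{1/σ}(0,1)`. -/
def MemL2sig (a b u : ℝ → ℝ) : Prop :=
  IntegrableOn (fun x => (u x) ^ 2) (Set.Ioo (0:ℝ) 1) ∧
  IntegrableOn (fun x => (u x) ^ 2 / sigW a b x) (Set.Ioo (0:ℝ) 1)

/-- `u ∈ H¹_{1/σ}(0,1)`. -/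
structure MemH1sig (a b u u' : ℝ → ℝ) extends MemH1 u u' : Prop where
  l2sig : MemL2sig a b u

/-- `u ∈ H¹_{1/σ,0}(0,1)`. -/
structure MemH1sig0 (a b u u' : ℝ → ℝ) extends MemH1sig a b u u' : Prop where
  zero : u 0 = 0

/-- `u ∈ H²_{1/σ}(0,1)`: `η u'` is locally absolutely continuous on `(0,1]`
with derivative `w`, and `Au = σ (η u')' = σ w ∈ L²_{1/σ}`. -/
structure MemH2sig (a b u u' w : ℝ → ℝ) extends MemH1sig a b u u' : Prop where
  w_locint : ∀ c ∈ Set.Ioc (0:ℝ) 1, IntegrableOn w (Set.Icc c 1)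
  locAC : ∀ c ∈ Set.Ioc (0:ℝ) 1, ∀ x ∈ Set.Icc c 1,
    etaW a b x * u' x = etaW a b c * u' c + ∫ t in Set.Ioo c x, w t
  Au_l2sig : MemL2sig a b (fun x => sigW a b x * w x)

/-- `u ∈ H²_{1/σ,0}(0,1)`. -/
structure MemH2sig0 (a b u u' w : ℝ → ℝ) extends MemH2sig a b u u' w : Prop where
  zero : u 0 = 0

/-- Hypothesis (H0): there is `K > 0` such that `x ↦ x^K / a x` is nondecreasing
in a right neighborhood of `0`. -/
def HypH0K (a : ℝ → ℝ) (K : ℝ) : Prop :=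
  0 < K ∧ ∃ ε > (0:ℝ), ∀ x y : ℝ, 0 < x → x ≤ y → y ≤ ε →
    x ^ K / a x ≤ y ^ K / a y

def HypH0 (a : ℝ → ℝ) : Prop := ∃ K : ℝ, HypH0K a K

/-- `a` is weakly degenerate at `0` with constant
`K = sup_{x ∈ (0,1]} x|a'(x)|/a(x) ∈ (0,1)`. -/
def IsWD (a a' : ℝ → ℝ) (K : ℝ) : Prop :=
  ContinuousOn a (Set.Icc 0 1) ∧ a 0 = 0 ∧ (∀ x ∈ Set.Ioc (0:ℝ) 1, 0 < a x) ∧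
  (∀ x ∈ Set.Ioc (0:ℝ) 1, HasDerivAt a (a' x) x) ∧
  ContinuousOn a' (Set.Ioc 0 1) ∧
  IsLUB ((fun x => x * |a' x| / a x) '' Set.Ioc (0:ℝ) 1) K ∧ 0 < K ∧ K < 1

/-- `a` is strongly degenerate at `0` with constant
`K = sup_{x ∈ (0,1]} x|a'(x)|/a(x) ∈ [1,2)`. -/
def IsSD (a a' : ℝ → ℝ) (K : ℝ) : Prop :=
  ContinuousOn a (Set.Icc 0 1) ∧ a 0 = 0 ∧ (∀ x ∈ Set.Ioc (0:ℝ) 1, 0 < a x) ∧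
  (∀ x ∈ Set.Icc (0:ℝ) 1, HasDerivWithinAt a (a' x) (Set.Icc 0 1) x) ∧
  ContinuousOn a' (Set.Icc 0 1) ∧
  IsLUB ((fun x => x * |a' x| / a x) '' Set.Ioc (0:ℝ) 1) K ∧ 1 ≤ K ∧ K < 2

/-- Hypothesis (H1): `b/a ∈ L¹(0,1)`, `b` continuous, `a` is (WD) or (SD) with
constant `K`, and if `K > 1` then `x b(x)/a(x) ∈ L^∞(0,1)`. -/
def HypH1 (a a' b : ℝ → ℝ) (K : ℝ) : Prop :=
  (IsWD a a' K ∨ IsSD a a' K) ∧ ContinuousOn b (Set.Icc 0 1) ∧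
  MeasureTheory.IntegrableOn (fun x => b x / a x) (Set.Ioo (0:ℝ) 1) ∧
  (1 < K → ∃ M : ℝ, ∀ x ∈ Set.Ioo (0:ℝ) 1, |x * b x / a x| ≤ M)

/-- Hypothesis (H2): (H1) and `(2-K) a(x) - 2x|b(x)| ≥ ε₀ a(x)` on `[0,1]`. -/
def HypH2 (a a' b : ℝ → ℝ) (K ε₀ : ℝ) : Prop :=
  HypH1 a a' b K ∧ 0 < ε₀ ∧
  ∀ x ∈ Set.Icc (0:ℝ) 1, ε₀ * a x ≤ (2 - K) * a x - 2 * x * |b x|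

/-- A classical solution of the damped degenerate wave equation
`y_tt = a y_xx + b y_x`, `y(t,0) = 0`, `y_t(t,1) + η(1) y_x(t,1) + β y(t,1) = 0`,
with the regularity, integrability and differentiation-under-the-integral
properties required of classical solutions. -/
structure ClassicalSol (a b : ℝ → ℝ) (β : ℝ)
    (y yt yx ytt ytx yxx : ℝ → ℝ → ℝ) : Prop where
  dt : ∀ t x, 0 ≤ t → x ∈ Set.Icc (0:ℝ) 1 → HasDerivAt (fun s => y s x) (yt t x) t
  dtt : ∀ t x, 0 ≤ t → x ∈ Set.Icc (0:ℝ) 1 → HasDerivAt (fun s => yt s x) (ytt t x) t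
  dx : ∀ t x, 0 ≤ t → x ∈ Set.Ioc (0:ℝ) 1 → HasDerivAt (fun ξ => y t ξ) (yx t x) x
  dtx : ∀ t x, 0 ≤ t → x ∈ Set.Ioc (0:ℝ) 1 → HasDerivAt (fun ξ => yt t ξ) (ytx t x) x
  dxx : ∀ t x, 0 ≤ t → x ∈ Set.Ioc (0:ℝ) 1 → HasDerivAt (fun ξ => yx t ξ) (yxx t x) x
  cont_tt : ContinuousOn (Function.uncurry ytt) (Set.Ici 0 ×ˢ Set.Ioc (0:ℝ) 1)
  cont_tx : ContinuousOn (Function.uncurry ytx) (Set.Ici 0 ×ˢ Set.Ioc (0:ℝ) 1)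
  cont_xx : ContinuousOn (Function.uncurry yxx) (Set.Ici 0 ×ˢ Set.Ioc (0:ℝ) 1)
  pde : ∀ t x, 0 < t → x ∈ Set.Ioo (0:ℝ) 1 → ytt t x = a x * yxx t x + b x * yx t x
  bc0 : ∀ t, 0 ≤ t → y t 0 = 0
  bc1 : ∀ t, 0 < t → yt t 1 + etaW a b 1 * yx t 1 + β * y t 1 = 0
  regx : ∀ t, 0 ≤ t → MemH2sig0 a b (y t) (yx t)
    (fun x => etaW a b x * (b x / a x * yx t x + yxx t x))
  regt : ∀ t, 0 ≤ t → MemH1sig0 a b (yt t) (ytx t)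
  ediff : ∀ t, 0 ≤ t → HasDerivAt
    (fun s => ∫ x in Set.Ioo (0:ℝ) 1,
      ((yt s x) ^ 2 / sigW a b x + etaW a b x * (yx s x) ^ 2))
    (∫ x in Set.Ioo (0:ℝ) 1,
      (2 * yt t x * ytt t x / sigW a b x + 2 * etaW a b x * yx t x * ytx t x)) t
  intQ : ∀ s T : ℝ, 0 < s → s < T →
    MeasureTheory.IntegrableOn
      (fun p : ℝ × ℝ => (yt p.1 p.2) ^ 2 / sigW a b p.2)
      (Set.Ioo s T ×ˢ Set.Ioo (0:ℝ) 1) ∧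
    MeasureTheory.IntegrableOn
      (fun p : ℝ × ℝ => etaW a b p.2 * (yx p.1 p.2) ^ 2)
      (Set.Ioo s T ×ˢ Set.Ioo (0:ℝ) 1)
  intBdry : ∀ s T : ℝ, 0 < s → s < T →
    MeasureTheory.IntegrableOn (fun t => (yt t 1) ^ 2) (Set.Ioo s T) ∧
    MeasureTheory.IntegrableOn (fun t => (yx t 1) ^ 2) (Set.Ioo s T) ∧
    MeasureTheory.IntegrableOn (fun t => (y t 1) ^ 2) (Set.Ioo s T)

/-- The energy of a solution `y`:
`E_y(t) = (1/2) [∫₀¹ (y_t²/σ + η y_x²) dx + β y(t,1)²]`. -/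
noncomputable def energy (a b : ℝ → ℝ) (β : ℝ) (y yt yx : ℝ → ℝ → ℝ) (t : ℝ) : ℝ :=
  (1/2) * ((∫ x in Set.Ioo (0:ℝ) 1,
    ((yt t x) ^ 2 / sigW a b x + etaW a b x * (yx t x) ^ 2)) + β * (y t 1) ^ 2)

lemma continuousOn_uncurry_of_hasDerivWithinAt {f ft : ℝ → ℝ → ℝ}
    (hft : ∀ x ∈ Ioc (0:ℝ) 1, ∀ t ∈ Ici (0:ℝ),
      HasDerivWithinAt (fun s => f s x) (ft t x) (Ici 0) t)
    (hfx : ∀ t ∈ Ici (0:ℝ), ContinuousOn (f t) (Ioc 0 1))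
    (hc : ContinuousOn (Function.uncurry ft) (Ici 0 ×ˢ Ioc (0:ℝ) 1)) :
    ContinuousOn (Function.uncurry f) (Ici 0 ×ˢ Ioc (0:ℝ) 1) := by
  rintro ⟨t, x⟩ ⟨ht, hx⟩
  simp only [mem_Ici, mem_Ioc] at ht hx
  have hsub1 : Icc 0 (t + 1) ⊆ Ici (0:ℝ) := fun u hu => hu.1
  have hsub2 : Icc (x / 2) 1 ⊆ Ioc (0:ℝ) 1 := fun u hu => ⟨by linarith [hu.1], hu.2⟩
  obtain ⟨M, hM⟩ := (isCompact_Icc.prod isCompact_Icc).exists_bound_of_continuousOn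
    (hc.mono (prod_mono hsub1 hsub2))
  have key : ContinuousOn (Function.uncurry f) (Icc 0 (t + 1) ×ˢ Icc (x / 2) 1) := by
    refine continuousOn_prod_of_continuousOn_lipschitzOnWith _ (Real.toNNReal M) ?_ ?_
    · intro u hu
      exact (hfx u (hsub1 hu)).mono hsub2
    · intro v hv
      refine Convex.lipschitzOnWith_of_nnnorm_hasDerivWithin_le (f' := fun u => ft u v)
        (convex_Icc _ _) ?_ ?_
      · intro u hu
        exact (hft v (hsub2 hv) u (hsub1 hu)).mono hsub1
      · intro u hu
        exact NNReal.le_toNNReal_of_coe_le (hM (u, v) ⟨hu, hv⟩)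
  refine (key (t, x) ⟨⟨ht, by linarith⟩, ⟨by linarith, hx.2⟩⟩).mono_of_mem_nhdsWithin ?_
  rw [nhdsWithin_prod_eq]
  refine prod_mem_prod ?_ ?_
  · filter_upwards [self_mem_nhdsWithin, mem_nhdsWithin_of_mem_nhds (Iio_mem_nhds (lt_add_one t))]
      with u hu hu' using ⟨hu, le_of_lt hu'⟩
  · filter_upwards [self_mem_nhdsWithin,
      mem_nhdsWithin_of_mem_nhds (Ioi_mem_nhds (half_lt_self hx.1))]
      with u hu hu' using ⟨le_of_lt hu', hu.2⟩

lemma continuousOn_section_left {f : ℝ → ℝ → ℝ} {S X : Set ℝ}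
    (hf : ContinuousOn (Function.uncurry f) (S ×ˢ X)) {x : ℝ} (hx : x ∈ X) :
    ContinuousOn (fun t => f t x) S :=
  hf.comp (f := fun t => (t, x)) (by fun_prop) fun _ ht => ⟨ht, hx⟩

lemma continuousOn_section_right {f : ℝ → ℝ → ℝ} {S X : Set ℝ}
    (hf : ContinuousOn (Function.uncurry f) (S ×ˢ X)) {t : ℝ} (ht : t ∈ S) :
    ContinuousOn (f t) X :=
  hf.comp (f := fun x => (t, x)) (by fun_prop) fun _ hx => ⟨ht, hx⟩

/-- Equality of mixed derivatives, in integrated form and up to the edge `x = 1`. -/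
lemma sub_eq_integral_of_mixed {y yt yx ytx : ℝ → ℝ → ℝ}
    (dt : ∀ t x, 0 ≤ t → x ∈ Icc (0:ℝ) 1 → HasDerivAt (fun s => y s x) (yt t x) t)
    (dx : ∀ t x, 0 ≤ t → x ∈ Ioc (0:ℝ) 1 → HasDerivAt (fun ξ => y t ξ) (yx t x) x)
    (dtx : ∀ t x, 0 ≤ t → x ∈ Ioc (0:ℝ) 1 → HasDerivAt (fun ξ => yt t ξ) (ytx t x) x)
    (cyx : ∀ t, 0 ≤ t → ContinuousOn (yx t) (Ioc 0 1))
    (cyt : ContinuousOn (Function.uncurry yt) (Ici 0 ×ˢ Ioc (0:ℝ) 1))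
    (cytx : ContinuousOn (Function.uncurry ytx) (Ici 0 ×ˢ Ioc (0:ℝ) 1))
    {t x : ℝ} (ht : 0 ≤ t) (hx : x ∈ Ioc (0:ℝ) 1) :
    yx t x = yx 0 x + ∫ τ in (0:ℝ)..t, ytx τ x := by
  have hsubt : uIcc 0 t ⊆ Ici (0:ℝ) := by
    rw [uIcc_of_le ht]; exact fun u hu => hu.1
  have hsubt' : uIoc 0 t ⊆ Ici (0:ℝ) := uIoc_subset_uIcc.trans hsubt
  have hint : ∀ {g : ℝ → ℝ → ℝ}, ContinuousOn (Function.uncurry g) (Ici 0 ×ˢ Ioc (0:ℝ) 1) →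
      ∀ z ∈ Ioc (0:ℝ) 1, IntervalIntegrable (fun τ => g τ z) volume 0 t := fun hg z hz =>
    ((continuousOn_section_left hg hz).mono hsubt).intervalIntegrable
  have hbd : ∀ c ∈ Ioc (0:ℝ) 1, ∃ M, ∀ τ ∈ uIoc 0 t, ∀ z ∈ Icc c 1, ‖ytx τ z‖ ≤ M := by
    intro c hc
    obtain ⟨M, hM⟩ := (isCompact_uIcc (a := (0:ℝ)) (b := t)).prod
      (isCompact_Icc (a := c) (b := (1:ℝ))) |>.exists_bound_of_continuousOn
      (cytx.mono (prod_mono hsubt fun z hz => ⟨hc.1.trans_le hz.1, hz.2⟩))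
    exact ⟨M, fun τ hτ z hz => hM (τ, z) ⟨uIoc_subset_uIcc hτ, hz⟩⟩
  have hinner : ∀ z ∈ Ioo (0:ℝ) 1, yx t z = yx 0 z + ∫ τ in (0:ℝ)..t, ytx τ z := by
    intro z hz
    obtain ⟨M, hM⟩ := hbd (z / 2) ⟨by linarith [hz.1], by linarith [hz.1, hz.2]⟩
    have hnhds : Ioo (z / 2) 1 ∈ 𝓝 z := Ioo_mem_nhds (by linarith [hz.1]) hz.2
    have hsubz : Ioo (z / 2) 1 ⊆ Ioc (0:ℝ) 1 := fun u hu =>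
      ⟨by linarith [hu.1, hz.1], hu.2.le⟩
    have hder := (intervalIntegral.hasDerivAt_integral_of_dominated_loc_of_deriv_le
      (F := fun ξ τ => yt τ ξ) (F' := fun ξ τ => ytx τ ξ) (x₀ := z) (a := 0) (b := t)
      (μ := volume) (bound := fun _ => M) hnhds
      (by
        filter_upwards [hnhds] with ξ hξ
        exact (intervalIntegrable_iff.1 (hint cyt ξ (hsubz hξ))).aestronglyMeasurable)
      (hint cyt z ⟨hz.1, hz.2.le⟩)
      (intervalIntegrable_iff.1 (hint cytx z ⟨hz.1, hz.2.le⟩)).aestronglyMeasurable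
      (Eventually.of_forall fun τ hτ ξ hξ => hM τ hτ ξ ⟨hξ.1.le, hξ.2.le⟩)
      intervalIntegrable_const
      (Eventually.of_forall fun τ hτ ξ hξ => dtx τ ξ (hsubt' hτ) (hsubz hξ))).2
    have heq : (fun ξ => y t ξ) =ᶠ[𝓝 z] fun ξ => y 0 ξ + ∫ τ in (0:ℝ)..t, yt τ ξ := by
      filter_upwards [hnhds] with ξ hξ
      have hξ' := hsubz hξ
      rw [intervalIntegral.integral_eq_sub_of_hasDerivAt
        (fun τ hτ => dt τ ξ (hsubt hτ) ⟨hξ'.1.le, hξ'.2⟩) (hint cyt ξ hξ')]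
      ring
    exact (dx t z ht ⟨hz.1, hz.2.le⟩).unique
      (((dx 0 z le_rfl ⟨hz.1, hz.2.le⟩).add hder).congr_of_eventuallyEq heq)
  rcases hx.2.lt_or_eq with hlt | rfl
  · exact hinner x ⟨hx.1, hlt⟩
  have hmem : Ioo (0:ℝ) 1 ∈ 𝓝[<] (1:ℝ) := Ioo_mem_nhdsLT one_pos
  have hlim : ∀ r, 0 ≤ r → Tendsto (yx r) (𝓝[<] 1) (𝓝 (yx r 1)) := fun r hr =>
    ((cyx r hr 1 hx).mono_of_mem_nhdsWithin
      (mem_of_superset hmem fun u hu => ⟨hu.1, hu.2.le⟩)).tendsto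
  obtain ⟨M, hM⟩ := hbd (1 / 2) ⟨by norm_num, by norm_num⟩
  have hhalf : Ioo (1 / 2 : ℝ) 1 ∈ 𝓝[<] (1:ℝ) := Ioo_mem_nhdsLT (by norm_num)
  have hI : Tendsto (fun z => ∫ τ in (0:ℝ)..t, ytx τ z) (𝓝[<] 1)
      (𝓝 (∫ τ in (0:ℝ)..t, ytx τ 1)) := by
    refine intervalIntegral.tendsto_integral_filter_of_dominated_convergence (fun _ => M) ?_ ?_
      intervalIntegrable_const ?_
    · filter_upwards [hmem] with z hz
      exact (intervalIntegrable_iff.1 (hint cytx z ⟨hz.1, hz.2.le⟩)).aestronglyMeasurable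
    · filter_upwards [hhalf] with z hz
      exact Eventually.of_forall fun τ hτ => hM τ hτ z ⟨hz.1.le, hz.2.le⟩
    · refine Eventually.of_forall fun τ hτ => ?_
      exact ((continuousOn_section_right cytx (hsubt' hτ) 1 hx).mono_of_mem_nhdsWithin
        (mem_of_superset hmem fun u hu => ⟨hu.1, hu.2.le⟩)).tendsto
  refine tendsto_nhds_unique (hlim t ht) (((hlim 0 le_rfl).add hI).congr' ?_)
  filter_upwards [hmem] with z hz using (hinner z hz).symm

lemma hasDerivWithinAt_of_eq_integral {g g' : ℝ → ℝ}
    (hg : ∀ t, 0 ≤ t → g t = g 0 + ∫ τ in (0:ℝ)..t, g' τ) (hc : ContinuousOn g' (Ici 0))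
    {t : ℝ} (ht : 0 ≤ t) : HasDerivWithinAt g (g' t) (Ici 0) t := by
  let G : ℝ → ℝ := fun τ => g' (max 0 τ)
  have hG : Continuous G :=
    hc.comp_continuous (by fun_prop) fun τ => mem_Ici.2 (le_max_left _ _)
  have h1 := ((hG.integral_hasStrictDerivAt 0 t).hasDerivAt.const_add (g 0)).hasDerivWithinAt
    (s := Ici 0)
  have hGt : G t = g' t := by simp [G, ht]
  rw [← hGt]
  refine h1.congr_of_mem (fun u hu => ?_) ht
  rw [hg u hu]
  congr 1
  refine intervalIntegral.integral_congr fun τ hτ => ?_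
  rw [uIcc_of_le hu] at hτ
  simp [G, hτ.1]

/-- A function dominated near `0` by `ε φ(ε) + o(1)` with `φ` integrable can only have limit `0`,
since `1/ε` is not integrable. -/
lemma limit_eq_zero_of_abs_le {h φ Φ : ℝ → ℝ} {L : ℝ}
    (hL : Tendsto h (𝓝[>] 0) (𝓝 L)) (hφ : IntegrableOn φ (Ioo 0 1))
    (hΦ : Tendsto Φ (𝓝[>] 0) (𝓝 0))
    (hle : ∀ ε ∈ Ioo (0:ℝ) 1, |h ε| ≤ ε * φ ε + Φ ε) : L = 0 := by
  by_contra hne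
  have hpos : 0 < |L| := abs_pos.2 hne
  have h1 : ∀ᶠ ε in 𝓝[>] (0:ℝ), |L| / 2 ≤ ε * φ ε ∧ ε < 1 := by
    filter_upwards [hL.abs.eventually (lt_mem_nhds (show |L| * (3 / 4) < |L| by linarith)),
      hΦ.eventually (gt_mem_nhds (show 0 < |L| / 4 by linarith)),
      Ioo_mem_nhdsGT (zero_lt_one' ℝ)] with ε ha hb hc
    exact ⟨by linarith [hle ε hc], hc.2⟩
  obtain ⟨δ, hδ, hsub⟩ := mem_nhdsGT_iff_exists_Ioo_subset.1 h1
  have hδ : 0 < δ := hδ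
  have hsub1 : Ioo 0 δ ⊆ Ioo (0:ℝ) 1 := fun u hu => ⟨hu.1, (hsub hu).2⟩
  have hint : IntegrableOn (fun x : ℝ => x⁻¹) (Ioo 0 δ) := by
    refine Integrable.mono' ((hφ.mono_set hsub1).const_mul (2 / |L|)) (by fun_prop) ?_
    filter_upwards [ae_restrict_mem measurableSet_Ioo] with x hx
    have h2 := (hsub hx).1
    have hx0 := hx.1
    rw [Real.norm_of_nonneg (by positivity), inv_le_iff_one_le_mul₀ hx0,
      show 2 / |L| * φ x * x = (x * φ x) / (|L| / 2) by field_simp,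
      one_le_div (by positivity)]
    exact h2
  have := intervalIntegrable_inv_iff.1
    ((intervalIntegrable_iff_integrableOn_Ioo_of_le hδ.le).2 hint)
  rcases this with h0 | h0
  · exact hδ.ne h0
  · exact h0 left_mem_uIcc

/-- Integrated form of `F = ∂ₜ G + ∂ₓ H` on `(s,T) × (0,1)` when the flux `H` is singular at
`x = 0` but is controlled by integrable quantities. -/
lemma integral_of_divergence_form {F G Gt H Hx : ℝ → ℝ → ℝ} {φ Φ : ℝ → ℝ} {s T : ℝ} (hsT : s ≤ T)
    (hF : IntegrableOn (Function.uncurry F) (Ioo s T ×ˢ Ioo 0 1))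
    (hFGH : ∀ t ∈ Ioo s T, ∀ x ∈ Ioo (0:ℝ) 1, F t x = Gt t x + Hx t x)
    (hG : ∀ x ∈ Ioo (0:ℝ) 1, ∀ t ∈ Icc s T, HasDerivAt (fun r => G r x) (Gt t x) t)
    (hGt : ∀ x ∈ Ioo (0:ℝ) 1, ContinuousOn (fun t => Gt t x) (Icc s T))
    (hGi : ∀ t ∈ Icc s T, IntegrableOn (G t) (Ioo 0 1))
    (hH : ∀ t ∈ Icc s T, ∀ x ∈ Ioo (0:ℝ) 1, HasDerivAt (H t) (Hx t x) x)
    (hHc : ContinuousOn (Function.uncurry H) (Icc s T ×ˢ Ioc 0 1))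
    (hHx : ContinuousOn (Function.uncurry Hx) (Icc s T ×ˢ Ioc 0 1))
    (hφ : IntegrableOn φ (Ioo 0 1)) (hΦ : Tendsto Φ (𝓝[>] 0) (𝓝 0))
    (hle : ∀ ε ∈ Ioo (0:ℝ) 1, |∫ t in Ioo s T, H t ε| ≤ ε * φ ε + Φ ε) :
    ∫ t in Ioo s T, ∫ x in Ioo (0:ℝ) 1, F t x
      = (∫ x in Ioo (0:ℝ) 1, (G T x - G s x)) + ∫ t in Ioo s T, H t 1 := by
  have hprod : ((volume : Measure ℝ).restrict (Ioo s T)).prod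
      ((volume : Measure ℝ).restrict (Ioo 0 1)) =
      (volume : Measure (ℝ × ℝ)).restrict (Ioo s T ×ˢ Ioo 0 1) := by
    rw [Measure.prod_restrict]; rfl
  have hF' : Integrable (Function.uncurry F)
      (((volume : Measure ℝ).restrict (Ioo s T)).prod
        ((volume : Measure ℝ).restrict (Ioo 0 1))) := by
    rw [hprod]; exact hF
  have hGi' : IntegrableOn (fun x => G T x - G s x) (Ioo 0 1) :=
    (hGi T ⟨hsT, le_rfl⟩).sub (hGi s ⟨le_rfl, hsT⟩)
  let k : ℝ → ℝ := fun x => ∫ t in Ioo s T, Hx t x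
  have hsec : ∀ x ∈ Ioo (0:ℝ) 1, IntegrableOn (fun t => Hx t x) (Ioo s T) := fun x hx =>
    (continuousOn_section_left hHx ⟨hx.1, hx.2.le⟩).integrableOn_Icc.mono_set Ioo_subset_Icc_self
  have hk : ∀ x ∈ Ioo (0:ℝ) 1, (∫ t in Ioo s T, F t x) - (G T x - G s x) = k x := by
    intro x hx
    have h1 : ∫ t in Ioo s T, Gt t x = G T x - G s x := by
      rw [← integral_Ioc_eq_integral_Ioo, ← intervalIntegral.integral_of_le hsT]
      refine intervalIntegral.integral_eq_sub_of_hasDerivAt (f := fun r => G r x) ?_ ?_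
      · rw [uIcc_of_le hsT]; exact hG x hx
      · refine ContinuousOn.intervalIntegrable ?_
        rw [uIcc_of_le hsT]; exact hGt x hx
    rw [setIntegral_congr_fun measurableSet_Ioo fun t ht => hFGH t ht x hx, integral_add
      ((hGt x hx).integrableOn_Icc.mono_set Ioo_subset_Icc_self) (hsec x hx), h1]
    ring
  have hfi : IntegrableOn (fun x => ∫ t in Ioo s T, F t x) (Ioo 0 1) := hF'.integral_prod_right
  have hki : IntegrableOn k (Ioo 0 1) :=
    (hfi.sub hGi').congr_fun hk measurableSet_Ioo
  have hkint : ∫ x in Ioo (0:ℝ) 1, k x =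
      (∫ t in Ioo s T, ∫ x in Ioo (0:ℝ) 1, F t x) - ∫ x in Ioo (0:ℝ) 1, (G T x - G s x) := by
    rw [← setIntegral_congr_fun measurableSet_Ioo hk, integral_sub hfi hGi',
      integral_integral_swap hF']
  have hHt : ∀ x ∈ Ioc (0:ℝ) 1, IntegrableOn (fun t => H t x) (Ioo s T) := fun x hx =>
    (continuousOn_section_left hHc hx).integrableOn_Icc.mono_set Ioo_subset_Icc_self
  have hflux : ∀ ε ∈ Ioo (0:ℝ) 1,
      ∫ x in ε..1, k x = (∫ t in Ioo s T, H t 1) - ∫ t in Ioo s T, H t ε := by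
    intro ε hε
    have hsub : Icc ε 1 ⊆ Ioc (0:ℝ) 1 := fun u hu => ⟨hε.1.trans_le hu.1, hu.2⟩
    have hrect : Integrable (Function.uncurry fun x t => Hx t x)
        (((volume : Measure ℝ).restrict (uIoc ε 1)).prod
          ((volume : Measure ℝ).restrict (Ioo s T))) := by
      rw [Measure.prod_restrict]
      have hc : ContinuousOn (Function.uncurry fun x t => Hx t x) (Icc ε 1 ×ˢ Icc s T) :=
        hHx.comp (f := Prod.swap) (by fun_prop) fun p hp => ⟨hp.2, hsub hp.1⟩
      refine (hc.integrableOn_compact (μ := volume.prod volume)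
        (isCompact_Icc.prod isCompact_Icc)).mono_set (prod_mono ?_ Ioo_subset_Icc_self)
      rw [uIoc_of_le hε.2.le]
      exact Ioc_subset_Icc_self
    rw [intervalIntegral_integral_swap hrect, ← integral_sub (hHt 1 ⟨one_pos, le_rfl⟩)
      (hHt ε ⟨hε.1, hε.2.le⟩)]
    refine setIntegral_congr_fun measurableSet_Ioo fun t ht => ?_
    have ht' := Ioo_subset_Icc_self ht
    refine intervalIntegral.integral_eq_sub_of_hasDerivAt_of_le hε.2.le
      ((continuousOn_section_right hHc ht').mono hsub)
      (fun x hx => hH t ht' x ⟨hε.1.trans hx.1, hx.2⟩) (ContinuousOn.intervalIntegrable ?_)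
    rw [uIcc_of_le hε.2.le]
    exact (continuousOn_section_right hHx ht').mono hsub
  have hki' : IntervalIntegrable k volume 0 1 :=
    (intervalIntegrable_iff_integrableOn_Ioo_of_le zero_le_one).2 hki
  have hmem : Ioo (0:ℝ) 1 ∈ 𝓝[>] (0:ℝ) := Ioo_mem_nhdsGT one_pos
  have hlim : Tendsto (fun ε => ∫ x in ε..1, k x) (𝓝[>] 0) (𝓝 (∫ x in (0:ℝ)..1, k x)) := by
    have := intervalIntegral.continuousOn_primitive_interval_left
      ((intervalIntegrable_iff').1 hki')
    rw [uIcc_of_le zero_le_one] at this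
    exact ((this 0 ⟨le_rfl, zero_le_one⟩).mono_of_mem_nhdsWithin
      (mem_of_superset hmem Ioo_subset_Icc_self)).tendsto
  have hh : Tendsto (fun ε => ∫ t in Ioo s T, H t ε) (𝓝[>] 0)
      (𝓝 ((∫ t in Ioo s T, H t 1) - ∫ x in (0:ℝ)..1, k x)) := by
    refine (tendsto_const_nhds.sub hlim).congr' ?_
    filter_upwards [hmem] with ε hε
    rw [hflux ε hε]; ring
  have hzero := limit_eq_zero_of_abs_le hh hφ hΦ hle
  rw [intervalIntegral.integral_of_le zero_le_one, integral_Ioc_eq_integral_Ioo, hkint] at hzero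
  linarith

lemma etaW_pos (a b : ℝ → ℝ) (x : ℝ) : 0 < etaW a b x := Real.exp_pos _

lemma continuousOn_etaW {a b : ℝ → ℝ} (hi : IntegrableOn (fun x => b x / a x) (Ioo (0:ℝ) 1)) :
    ContinuousOn (etaW a b) (Icc 0 1) := by
  have h1 : IntervalIntegrable (fun x => b x / a x) volume 0 1 :=
    (intervalIntegrable_iff_integrableOn_Ioo_of_le zero_le_one).2 hi
  have h2 := intervalIntegral.continuousOn_primitive_interval' (a := 1 / 2) h1
    (by rw [uIcc_of_le zero_le_one]; norm_num)
  rw [uIcc_of_le zero_le_one] at h2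
  exact h2.rexp

lemma hasDerivAt_etaW {a b : ℝ → ℝ} (hi : IntegrableOn (fun x => b x / a x) (Ioo (0:ℝ) 1))
    (hc : ContinuousOn (fun x => b x / a x) (Ioo (0:ℝ) 1)) {x : ℝ} (hx : x ∈ Ioo (0:ℝ) 1) :
    HasDerivAt (etaW a b) (etaW a b x * (b x / a x)) x := by
  have h1 : IntervalIntegrable (fun x => b x / a x) volume 0 1 :=
    (intervalIntegrable_iff_integrableOn_Ioo_of_le zero_le_one).2 hi
  refine (intervalIntegral.integral_hasDerivAt_right (h1.mono_set ?_)
    (hc.stronglyMeasurableAtFilter isOpen_Ioo x hx)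
    (hc.continuousAt (isOpen_Ioo.mem_nhds hx))).exp
  rw [uIcc_of_le zero_le_one]
  exact uIcc_subset_Icc (by norm_num) ⟨hx.1.le, hx.2.le⟩

lemma HypH1.degenerate {a a' b : ℝ → ℝ} {K : ℝ} (h : HypH1 a a' b K) :
    0 < K ∧ K < 2 ∧ ContinuousOn a (Icc 0 1) ∧ (∀ x ∈ Ioc (0:ℝ) 1, 0 < a x) ∧
    (∀ x ∈ Ioo (0:ℝ) 1, HasDerivAt a (a' x) x) ∧ ContinuousOn a' (Ioc 0 1) ∧
    ∀ x ∈ Ioc (0:ℝ) 1, |x * a' x / a x| ≤ K := by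
  have habs : ∀ {K : ℝ}, (∀ x ∈ Ioc (0:ℝ) 1, 0 < a x) →
      IsLUB ((fun x => x * |a' x| / a x) '' Ioc (0:ℝ) 1) K →
      ∀ x ∈ Ioc (0:ℝ) 1, |x * a' x / a x| ≤ K := by
    intro K hpos hK x hx
    rw [abs_div, abs_mul, abs_of_pos hx.1, abs_of_pos (hpos x hx)]
    exact hK.1 ⟨x, hx, rfl⟩
  rcases h.1 with ⟨h1, -, h3, h4, h5, h6, h7, h8⟩ | ⟨h1, -, h3, h4, h5, h6, h7, h8⟩
  · exact ⟨h7, by linarith, h1, h3, fun x hx => h4 x ⟨hx.1, hx.2.le⟩, h5, habs h3 h6⟩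
  · exact ⟨by linarith, h8, h1, h3, fun x hx => (h4 x ⟨hx.1.le, hx.2.le⟩).hasDerivAt
      (Icc_mem_nhds hx.1 hx.2), h5.mono Ioc_subset_Icc_self, habs h3 h6⟩

lemma pow_div_le_of_degenerate {a a' : ℝ → ℝ} {K : ℝ} (hc : ContinuousOn a (Icc 0 1))
    (hpos : ∀ x ∈ Ioc (0:ℝ) 1, 0 < a x) (hd : ∀ x ∈ Ioo (0:ℝ) 1, HasDerivAt a (a' x) x)
    (hK : ∀ x ∈ Ioc (0:ℝ) 1, |x * a' x / a x| ≤ K) {m : ℕ} (hm : K ≤ m + 1)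
    {x : ℝ} (hx : x ∈ Ioc (0:ℝ) 1) : x ^ (m + 1) / a x ≤ 1 / a 1 := by
  have hder : ∀ z ∈ Ioo (0:ℝ) 1, HasDerivAt (fun z => z ^ (m + 1) / a z)
      ((((m + 1 : ℕ) : ℝ) * z ^ m * a z - z ^ (m + 1) * a' z) / a z ^ 2) z := fun z hz =>
    (hasDerivAt_pow (m + 1) z).fun_div (hd z hz) (hpos z ⟨hz.1, hz.2.le⟩).ne'
  have hmono : MonotoneOn (fun z => z ^ (m + 1) / a z) (Ioc 0 1) := by
    refine monotoneOn_of_deriv_nonneg (convex_Ioc 0 1) ?_ ?_ ?_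
    · exact ContinuousOn.div (by fun_prop) (hc.mono Ioc_subset_Icc_self)
        fun z hz => (hpos z hz).ne'
    · rw [interior_Ioc]
      exact fun z hz => (hder z hz).differentiableAt.differentiableWithinAt
    · rw [interior_Ioc]
      intro z hz
      rw [(hder z hz).deriv]
      have ha := hpos z ⟨hz.1, hz.2.le⟩
      have h1 : z * a' z ≤ (m + 1) * a z :=
        (div_le_iff₀ ha).1 ((le_abs_self _).trans ((hK z ⟨hz.1, hz.2.le⟩).trans hm))
      have h2 : 0 ≤ z ^ m * ((m + 1) * a z - z * a' z) :=
        mul_nonneg (pow_nonneg hz.1.le m) (by linarith)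
      refine div_nonneg ?_ (sq_nonneg _)
      push_cast
      rw [pow_succ]
      linarith
  simpa using hmono hx ⟨one_pos, le_rfl⟩ hx.2

lemma HypH1.drift_bounded {a a' b : ℝ → ℝ} {K : ℝ} (h : HypH1 a a' b K) :
    ∃ M : ℝ, ∀ x ∈ Ioo (0:ℝ) 1, |x * b x / a x| ≤ M := by
  obtain ⟨-, -, hc, hpos, hd, -, hK⟩ := h.degenerate
  by_cases hK1 : 1 < K
  · exact h.2.2.2 hK1
  obtain ⟨B, hB⟩ := isCompact_Icc.exists_bound_of_continuousOn h.2.1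
  refine ⟨1 / a 1 * B, fun x hx => ?_⟩
  have hx' : x ∈ Ioc (0:ℝ) 1 := ⟨hx.1, hx.2.le⟩
  have h1 := pow_div_le_of_degenerate hc hpos hd hK (m := 0) (by simpa using hK1) hx'
  have h2 := hpos x hx'
  rw [zero_add, pow_one] at h1
  rw [show x * b x / a x = x / a x * b x by ring, abs_mul,
    abs_of_pos (div_pos hx.1 h2)]
  exact mul_le_mul h1 (hB x ⟨hx.1.le, hx.2.le⟩) (abs_nonneg _)
    (one_div_pos.2 (hpos 1 ⟨one_pos, le_rfl⟩)).le

lemma sq_integral_Ioo_le {f : ℝ → ℝ} {ε : ℝ} (hε : 0 < ε)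
    (hm : AEStronglyMeasurable f (volume.restrict (Ioo 0 ε)))
    (hf : IntegrableOn (fun x => f x ^ 2) (Ioo 0 ε)) :
    (∫ x in Ioo 0 ε, f x) ^ 2 ≤ ε * ∫ x in Ioo 0 ε, f x ^ 2 := by
  have hconst : ∀ c : ℝ, IntegrableOn (fun _ => c) (Ioo 0 ε) := fun c => by simp
  have hfi : IntegrableOn f (Ioo 0 ε) := by
    refine Integrable.mono' (hf.add (hconst 1)) hm (Eventually.of_forall fun x => ?_)
    simp only [Pi.add_apply, Real.norm_eq_abs]
    nlinarith [sq_abs (f x), sq_nonneg (|f x| - 1)]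
  set I := ∫ x in Ioo 0 ε, f x
  have hnn : 0 ≤ ∫ x in Ioo 0 ε, (f x - I / ε) ^ 2 := integral_nonneg fun x => sq_nonneg _
  have hexp : ∫ x in Ioo 0 ε, (f x - I / ε) ^ 2 =
      (∫ x in Ioo 0 ε, f x ^ 2) - 2 * (I / ε) * I + (I / ε) ^ 2 * ε := by
    have hcst : ∫ _ in Ioo 0 ε, (I / ε) ^ 2 = (I / ε) ^ 2 * ε := by
      simp [hε.le, mul_comm]
    have hdiff : IntegrableOn (fun x => f x ^ 2 - 2 * (I / ε) * f x) (Ioo 0 ε) :=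
      hf.sub (hfi.const_mul _)
    rw [← hcst, ← integral_const_mul, ← integral_sub hf (hfi.const_mul _),
      ← integral_add hdiff (hconst _)]
    refine integral_congr_ae (Eventually.of_forall fun x => ?_)
    ring
  rw [hexp] at hnn
  have h1 : ε * (2 * (I / ε) * I - (I / ε) ^ 2 * ε) = I ^ 2 := by field_simp; ring
  nlinarith

lemma ClassicalSol.hasDerivWithinAt_yx {a b : ℝ → ℝ} {β : ℝ} {y yt yx ytt ytx yxx : ℝ → ℝ → ℝ}
    (hy : ClassicalSol a b β y yt yx ytt ytx yxx)
    (cyt : ContinuousOn (Function.uncurry yt) (Ici 0 ×ˢ Ioc (0:ℝ) 1))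
    {t x : ℝ} (ht : 0 ≤ t) (hx : x ∈ Ioc (0:ℝ) 1) :
    HasDerivWithinAt (fun r => yx r x) (ytx t x) (Ici 0) t :=
  hasDerivWithinAt_of_eq_integral (fun _ hr => sub_eq_integral_of_mixed hy.dt hy.dx hy.dtx
      (fun r hr z hz => (hy.dxx r z hr hz).continuousAt.continuousWithinAt) cyt hy.cont_tx hr hx)
    (continuousOn_section_left hy.cont_tx hx) ht

lemma ClassicalSol.continuousOn_yt {a b : ℝ → ℝ} {β : ℝ} {y yt yx ytt ytx yxx : ℝ → ℝ → ℝ}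
    (hy : ClassicalSol a b β y yt yx ytt ytx yxx) :
    ContinuousOn (Function.uncurry yt) (Ici 0 ×ˢ Ioc (0:ℝ) 1) :=
  continuousOn_uncurry_of_hasDerivWithinAt
    (fun x hx t ht => (hy.dtt t x ht (Ioc_subset_Icc_self hx)).hasDerivWithinAt)
    (fun t ht x hx => (hy.dtx t x ht hx).continuousAt.continuousWithinAt) hy.cont_tt

lemma ClassicalSol.continuousOn_y {a b : ℝ → ℝ} {β : ℝ} {y yt yx ytt ytx yxx : ℝ → ℝ → ℝ}
    (hy : ClassicalSol a b β y yt yx ytt ytx yxx) :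
    ContinuousOn (Function.uncurry y) (Ici 0 ×ˢ Ioc (0:ℝ) 1) :=
  continuousOn_uncurry_of_hasDerivWithinAt
    (fun x hx t ht => (hy.dt t x ht (Ioc_subset_Icc_self hx)).hasDerivWithinAt)
    (fun t ht x hx => (hy.dx t x ht hx).continuousAt.continuousWithinAt) hy.continuousOn_yt

lemma ClassicalSol.continuousOn_yx {a b : ℝ → ℝ} {β : ℝ} {y yt yx ytt ytx yxx : ℝ → ℝ → ℝ}
    (hy : ClassicalSol a b β y yt yx ytt ytx yxx) :
    ContinuousOn (Function.uncurry yx) (Ici 0 ×ˢ Ioc (0:ℝ) 1) :=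
  continuousOn_uncurry_of_hasDerivWithinAt
    (fun _ hx _ ht => hy.hasDerivWithinAt_yx hy.continuousOn_yt ht hx)
    (fun t ht x hx => (hy.dxx t x ht hx).continuousAt.continuousWithinAt) hy.cont_tx

lemma sigW_pos {a b : ℝ → ℝ} {x : ℝ} (h : 0 < a x) : 0 < sigW a b x :=
  div_pos h (etaW_pos a b x)

lemma HypH1.continuousOn_sigW {a a' b : ℝ → ℝ} {K : ℝ} (h : HypH1 a a' b K) :
    ContinuousOn (sigW a b) (Icc 0 1) :=
  h.degenerate.2.2.1.div (continuousOn_etaW h.2.2.1) fun x _ => (etaW_pos a b x).ne'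

lemma HypH1.etaW_le {a a' b : ℝ → ℝ} {K : ℝ} (h : HypH1 a a' b K) :
    ∃ C, (∀ x ∈ Icc (0:ℝ) 1, etaW a b x ≤ C) ∧
      ∀ x ∈ Icc (0:ℝ) 1, 1 ≤ C * etaW a b x := by
  have hc := continuousOn_etaW h.2.2.1
  obtain ⟨C, hC⟩ := isCompact_Icc.exists_bound_of_continuousOn hc
  obtain ⟨B, hB⟩ := isCompact_Icc.exists_bound_of_continuousOn
    (hc.inv₀ fun x _ => (etaW_pos a b x).ne')
  refine ⟨max C B, fun x hx => ?_, fun x hx => ?_⟩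
  · exact ((le_abs_self _).trans (hC x hx)).trans (le_max_left _ _)
  · exact (inv_le_iff_one_le_mul₀ (etaW_pos a b x)).1
      (((le_abs_self _).trans (hB x hx)).trans (le_max_right _ _))

/-- The terms `x y_x y_t / σ` and `y y_t / σ` are integrable at each fixed time. -/
lemma ClassicalSol.integrableOn_slice {a a' b : ℝ → ℝ} {K β : ℝ}
    {y yt yx ytt ytx yxx : ℝ → ℝ → ℝ} (h : HypH1 a a' b K)
    (hy : ClassicalSol a b β y yt yx ytt ytx yxx) {t : ℝ} (ht : 0 ≤ t) :
    IntegrableOn (fun x => -(2 * x * yx t x * yt t x) / sigW a b x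
      + K / 2 * y t x * yt t x / sigW a b x) (Ioo 0 1) := by
  obtain ⟨hK0, hK2, ha, hpos, hd, -, hK⟩ := h.degenerate
  obtain ⟨C, hC, -⟩ := h.etaW_le
  have hsub : Ioo (0:ℝ) 1 ⊆ Ioc 0 1 := Ioo_subset_Ioc_self
  have cyt := (continuousOn_section_right hy.continuousOn_yt ht).mono hsub
  have cyx := (continuousOn_section_right hy.continuousOn_yx ht).mono hsub
  have cy := (continuousOn_section_right hy.continuousOn_y ht).mono hsub
  have cs := h.continuousOn_sigW.mono Ioo_subset_Icc_self
  have hs : ∀ x ∈ Ioo (0:ℝ) 1, sigW a b x ≠ 0 := fun x hx => (sigW_pos (hpos x (hsub hx))).ne'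
  have i1 := ((hy.regt t ht).l2sig.2)
  have i2 := ((hy.regx t ht).l2sig.2)
  have i3 := ((hy.regx t ht).deriv_sq_int)
  refine Integrable.mono' (((i3.const_mul (C / a 1)).add i1).add (i2.add i1)) ?_ ?_
  · refine ContinuousOn.aestronglyMeasurable ?_ measurableSet_Ioo
    exact (((((continuousOn_const.mul continuousOn_id).mul cyx).mul cyt).neg).div cs hs).add
      (((continuousOn_const.mul cy).mul cyt).div cs hs)
  · filter_upwards [ae_restrict_mem measurableSet_Ioo] with x hx
    have hσ : 0 < sigW a b x := sigW_pos (hpos x (hsub hx))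
    have hxσ : x ^ 2 / sigW a b x ≤ C / a 1 := by
      have h1 := pow_div_le_of_degenerate ha hpos hd hK (m := 1) (by norm_num; linarith) (hsub hx)
      have h2 := hpos 1 ⟨one_pos, le_rfl⟩
      calc x ^ 2 / sigW a b x = (x ^ 2 / a x) * etaW a b x := by
            rw [sigW, div_div_eq_mul_div, div_mul_eq_mul_div]
        _ ≤ 1 / a 1 * C := mul_le_mul h1 (hC x ⟨hx.1.le, hx.2.le⟩) (etaW_pos a b x).le (by positivity)
        _ = C / a 1 := by ring
    have e1 : |-(2 * x * yx t x * yt t x) / sigW a b x| ≤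
        C / a 1 * yx t x ^ 2 + yt t x ^ 2 / sigW a b x := by
      have h3 : |-(2 * x * yx t x * yt t x)| ≤ (x * yx t x) ^ 2 + yt t x ^ 2 := by
        rw [abs_le]; constructor <;>
          nlinarith [sq_nonneg (x * yx t x - yt t x), sq_nonneg (x * yx t x + yt t x)]
      rw [abs_div, abs_of_pos hσ]
      calc _ ≤ ((x * yx t x) ^ 2 + yt t x ^ 2) / sigW a b x := by gcongr
        _ = x ^ 2 / sigW a b x * yx t x ^ 2 + yt t x ^ 2 / sigW a b x := by ring
        _ ≤ _ := by gcongr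
    have e2 : |K / 2 * y t x * yt t x / sigW a b x| ≤
        y t x ^ 2 / sigW a b x + yt t x ^ 2 / sigW a b x := by
      have h3 : |K / 2 * y t x * yt t x| ≤ y t x ^ 2 + yt t x ^ 2 := by
        rw [mul_assoc, abs_mul, abs_of_pos (by linarith)]
        have h4 : |y t x * yt t x| ≤ y t x ^ 2 + yt t x ^ 2 := by
          rw [abs_le]; constructor <;>
            nlinarith [sq_nonneg (y t x - yt t x), sq_nonneg (y t x + yt t x)]
        exact (mul_le_of_le_one_left (abs_nonneg _) (by linarith)).trans h4
      rw [abs_div, abs_of_pos hσ, ← add_div]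
      gcongr
    simp only [Pi.add_apply, Real.norm_eq_abs]
    exact (abs_add_le _ _).trans (add_le_add e1 e2)

/-- The Hardy-type estimate `y(t,ε)² ≤ C ε ∫₀^ε η y_x²`. -/
lemma ClassicalSol.sq_le {a b : ℝ → ℝ} {β C : ℝ}
    {y yt yx ytt ytx yxx : ℝ → ℝ → ℝ}
    (hC : ∀ x ∈ Icc (0:ℝ) 1, 1 ≤ C * etaW a b x)
    (hy : ClassicalSol a b β y yt yx ytt ytx yxx) {t ε : ℝ} (ht : 0 ≤ t) (hε : ε ∈ Ioo (0:ℝ) 1)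
    (hP : IntegrableOn (fun x => etaW a b x * yx t x ^ 2) (Ioo 0 ε)) :
    y t ε ^ 2 ≤ ε * (C * ∫ x in Ioo 0 ε, etaW a b x * yx t x ^ 2) := by
  have hsub : Ioo (0:ℝ) ε ⊆ Ioo 0 1 := fun u hu => ⟨hu.1, hu.2.trans hε.2⟩
  have h1 := (hy.regx t ht).ftc ε ⟨hε.1.le, hε.2.le⟩
  rw [hy.bc0 t ht, zero_add] at h1
  have hi := (hy.regx t ht).deriv_sq_int.mono_set hsub
  rw [h1]
  refine (sq_integral_Ioo_le hε.1 (ContinuousOn.aestronglyMeasurable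
    ((continuousOn_section_right hy.continuousOn_yx ht).mono
      (hsub.trans Ioo_subset_Ioc_self)) measurableSet_Ioo) hi).trans ?_
  refine mul_le_mul_of_nonneg_left ?_ hε.1.le
  rw [← integral_const_mul]
  refine setIntegral_mono_on hi (hP.const_mul C) measurableSet_Ioo fun x hx => ?_
  have h2 := hC x (Ioo_subset_Icc_self (hsub hx))
  nlinarith [sq_nonneg (yx t x)]

lemma abs_flux_le {ε k e C E u v I : ℝ} (hε : 0 < ε) (hk0 : 0 ≤ k) (hk1 : k ≤ 1) (he : 0 ≤ e)
    (heC : e ≤ C) (hE : 0 ≤ E) (hI : 0 ≤ I) (hu : u ^ 2 ≤ ε * (C * I)) :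
    |ε * E + ε * e * (v * v) - k * e * u * v| ≤ ε * (2 * E + 2 * (e * v ^ 2)) + C ^ 2 * I := by
  have h1 : |u * v| ≤ C * I / 2 + ε * v ^ 2 / 2 := by
    have h2 : |u * v| * (2 * ε) ≤ (C * I / 2 + ε * v ^ 2 / 2) * (2 * ε) := by
      have h3 : (|u| - ε * |v|) ^ 2 = u ^ 2 - 2 * ε * |u * v| + ε ^ 2 * v ^ 2 := by
        rw [abs_mul, ← sq_abs u, ← sq_abs v]; ring
      nlinarith [sq_nonneg (|u| - ε * |v|)]
    exact le_of_mul_le_mul_right h2 (by positivity)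
  have h3 : |k * e * u * v| ≤ C ^ 2 * I / 2 + ε * (e * v ^ 2) / 2 := by
    have hke : k * e ≤ e := mul_le_of_le_one_left he hk1
    rw [mul_assoc, abs_mul, abs_of_nonneg (mul_nonneg hk0 he)]
    calc k * e * |u * v| ≤ e * (C * I / 2 + ε * v ^ 2 / 2) :=
          mul_le_mul hke h1 (abs_nonneg _) he
      _ = e * (C * I / 2) + ε * (e * v ^ 2) / 2 := by ring
      _ ≤ C * (C * I / 2) + ε * (e * v ^ 2) / 2 := by
          have : 0 ≤ C * I / 2 := by have := he.trans heC; positivity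
          gcongr
      _ = _ := by ring
  have h4 : 0 ≤ ε * E := by positivity
  have h5 : 0 ≤ ε * (e * v ^ 2) := by positivity
  have h6 : 0 ≤ C ^ 2 * I := by positivity
  rw [abs_le] at h3 ⊢
  constructor <;> nlinarith [h3.1, h3.2]

lemma integrable_prod_of_integrableOn {f : ℝ × ℝ → ℝ} {s T ε : ℝ} (hε : ε ≤ 1)
    (hf : IntegrableOn f (Ioo s T ×ˢ Ioo 0 1)) :
    Integrable f (((volume : Measure ℝ).restrict (Ioo s T)).prod
      ((volume : Measure ℝ).restrict (Ioo 0 ε))) := by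
  rw [Measure.prod_restrict]
  exact hf.mono_set (prod_mono le_rfl (Ioo_subset_Ioo le_rfl hε))

/-- The identity of Proposition 3.3: the weighted space-time integrals of
`y_t²` and `y_x²` equal the boundary terms (B.T.). -/
theorem stmt15 (a a' b : ℝ → ℝ) (K β : ℝ) (y yt yx ytt ytx yxx : ℝ → ℝ → ℝ)
    (hH1 : HypH1 a a' b K) (hβ : 0 ≤ β)
    (hy : ClassicalSol a b β y yt yx ytt ytx yxx) :
    ∀ s T : ℝ, 0 < s → s < T →
      (∫ t in Set.Ioo s T, ∫ x in Set.Ioo (0:ℝ) 1,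
          (1 - x * (a' x - b x) / a x + K / 2) * (1 / sigW a b x) * (yt t x) ^ 2)
        + (∫ t in Set.Ioo s T, ∫ x in Set.Ioo (0:ℝ) 1,
            (1 - x * b x / a x - K / 2) * etaW a b x * (yx t x) ^ 2)
      = (∫ x in Set.Ioo (0:ℝ) 1,
          ((-(2 * x * yx T x * yt T x) / sigW a b x + K / 2 * y T x * yt T x / sigW a b x)
            - (-(2 * x * yx s x * yt s x) / sigW a b x + K / 2 * y s x * yt s x / sigW a b x)))
        + (∫ t in Set.Ioo s T,
            ((yt t 1) ^ 2 / sigW a b 1 + etaW a b 1 * (yx t 1) ^ 2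
              - K / 2 * etaW a b 1 * y t 1 * yx t 1)) := by
  intro s T hs hsT
  obtain ⟨hK0, hK2, ha, hpos, hd, ha', hK⟩ := hH1.degenerate
  obtain ⟨C, hC, hC1⟩ := hH1.etaW_le
  obtain ⟨M, hM⟩ := hH1.drift_bounded
  obtain ⟨hE, hP⟩ := hy.intQ s T hs hsT
  have hη := etaW_pos a b
  have hsub : Ioo (0:ℝ) 1 ⊆ Ioc 0 1 := Ioo_subset_Ioc_self
  have htpos : ∀ t ∈ Icc s T, 0 ≤ t := fun t ht => hs.le.trans ht.1
  have hne : ∀ x ∈ Ioc (0:ℝ) 1, a x ≠ 0 := fun x hx => (hpos x hx).ne'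
  have hD : Icc s T ×ˢ Ioc (0:ℝ) 1 ⊆ Ici 0 ×ˢ Ioc 0 1 := prod_mono htpos le_rfl
  have cy : ContinuousOn (fun p : ℝ × ℝ => y p.1 p.2) (Icc s T ×ˢ Ioc (0:ℝ) 1) :=
    hy.continuousOn_y.mono hD
  have cyt : ContinuousOn (fun p : ℝ × ℝ => yt p.1 p.2) (Icc s T ×ˢ Ioc (0:ℝ) 1) :=
    hy.continuousOn_yt.mono hD
  have cyx : ContinuousOn (fun p : ℝ × ℝ => yx p.1 p.2) (Icc s T ×ˢ Ioc (0:ℝ) 1) :=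
    hy.continuousOn_yx.mono hD
  have cytt : ContinuousOn (fun p : ℝ × ℝ => ytt p.1 p.2) (Icc s T ×ˢ Ioc (0:ℝ) 1) :=
    hy.cont_tt.mono hD
  have cytx : ContinuousOn (fun p : ℝ × ℝ => ytx p.1 p.2) (Icc s T ×ˢ Ioc (0:ℝ) 1) :=
    hy.cont_tx.mono hD
  have cyxx : ContinuousOn (fun p : ℝ × ℝ => yxx p.1 p.2) (Icc s T ×ˢ Ioc (0:ℝ) 1) :=
    hy.cont_xx.mono hD
  have lift : ∀ {f : ℝ → ℝ}, ContinuousOn f (Ioc 0 1) →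
      ContinuousOn (fun p : ℝ × ℝ => f p.2) (Icc s T ×ˢ Ioc (0:ℝ) 1) := fun hf =>
    hf.comp continuousOn_snd fun p hp => hp.2
  have cη1 : ContinuousOn (etaW a b) (Ioc 0 1) :=
    (continuousOn_etaW hH1.2.2.1).mono Ioc_subset_Icc_self
  have cb1 : ContinuousOn b (Ioc 0 1) := hH1.2.1.mono Ioc_subset_Icc_self
  have ca1 : ContinuousOn a (Ioc 0 1) := ha.mono Ioc_subset_Icc_self
  have cia1 : ContinuousOn (fun x => (a x)⁻¹) (Ioc 0 1) := ca1.inv₀ hne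
  have cη := lift cη1
  have cia := lift cia1
  have bdd_mul : ∀ {c : ℝ → ℝ} {f : ℝ × ℝ → ℝ} {B : ℝ}, ContinuousOn c (Ioc 0 1) →
      (∀ x ∈ Ioo (0:ℝ) 1, |c x| ≤ B) → IntegrableOn f (Ioo s T ×ˢ Ioo 0 1) →
      IntegrableOn (fun p : ℝ × ℝ => c p.2 * f p) (Ioo s T ×ˢ Ioo 0 1) := by
    intro c f B hc hB hf
    refine Integrable.bdd_mul (c := B) hf (((lift hc).mono
      (prod_mono Ioo_subset_Icc_self hsub)).aestronglyMeasurable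
      (measurableSet_Ioo.prod measurableSet_Ioo)) ?_
    filter_upwards [ae_restrict_mem (measurableSet_Ioo.prod measurableSet_Ioo)] with p hp
    exact hB p.2 hp.2
  have hF1 : IntegrableOn (fun p : ℝ × ℝ => (1 - p.2 * (a' p.2 - b p.2) / a p.2 + K / 2)
      * (1 / sigW a b p.2) * (yt p.1 p.2) ^ 2) (Ioo s T ×ˢ Ioo 0 1) := by
    refine (bdd_mul (c := fun x => 1 - x * (a' x - b x) / a x + K / 2) (B := 1 + K + M + K / 2)
      (by fun_prop (disch := assumption)) ?_ hE).congr_fun (fun p hp => by ring)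
      (measurableSet_Ioo.prod measurableSet_Ioo)
    intro x hx
    have h1 := abs_le.1 (hK x (hsub hx))
    have h2 := abs_le.1 (hM x hx)
    rw [mul_sub, sub_div, abs_le]
    constructor <;> linarith [h1.1, h1.2, h2.1, h2.2]
  have hF2 : IntegrableOn (fun p : ℝ × ℝ => (1 - p.2 * b p.2 / a p.2 - K / 2)
      * etaW a b p.2 * (yx p.1 p.2) ^ 2) (Ioo s T ×ˢ Ioo 0 1) := by
    refine (bdd_mul (c := fun x => 1 - x * b x / a x - K / 2) (B := 1 + M + K / 2)
      (by fun_prop (disch := assumption)) ?_ hP).congr_fun (fun p hp => by ring)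
      (measurableSet_Ioo.prod measurableSet_Ioo)
    intro x hx
    have h2 := abs_le.1 (hM x hx)
    rw [abs_le]
    constructor <;> linarith [h2.1, h2.2]
  have hprodE := integrable_prod_of_integrableOn le_rfl hE
  have hprodP := integrable_prod_of_integrableOn le_rfl hP
  have hφ2 : IntegrableOn (fun x => ∫ t in Ioo s T, etaW a b x * yx t x ^ 2) (Ioo 0 1) :=
    hprodP.integral_prod_right
  have hφ : IntegrableOn (fun x => ∫ t in Ioo s T,
      (2 * (yt t x ^ 2 / sigW a b x) + 2 * (etaW a b x * yx t x ^ 2))) (Ioo 0 1) :=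
    ((hprodE.const_mul 2).add (hprodP.const_mul 2)).integral_prod_right
  have hΦ : Tendsto (fun ε => C ^ 2 * ∫ x in Ioo 0 ε, ∫ t in Ioo s T, etaW a b x * yx t x ^ 2)
      (𝓝[>] 0) (𝓝 0) := by
    have h1 := intervalIntegral.continuousOn_primitive_interval' (a := 0)
      ((intervalIntegrable_iff_integrableOn_Ioo_of_le zero_le_one).2 hφ2) left_mem_uIcc
    rw [uIcc_of_le zero_le_one] at h1
    have h2 := ((h1 0 ⟨le_rfl, zero_le_one⟩).mono_of_mem_nhdsWithin
      (mem_of_superset (Ioo_mem_nhdsGT one_pos) Ioo_subset_Icc_self)).tendsto.const_mul (C ^ 2)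
    simp only [intervalIntegral.integral_same, mul_zero] at h2
    refine h2.congr' ?_
    filter_upwards [self_mem_nhdsWithin] with ε hε
    rw [intervalIntegral.integral_of_le (le_of_lt hε), integral_Ioc_eq_integral_Ioo]
  have main := integral_of_divergence_form (s := s) (T := T) hsT.le
    (F := fun t x => (1 - x * (a' x - b x) / a x + K / 2) * (1 / sigW a b x) * (yt t x) ^ 2
      + (1 - x * b x / a x - K / 2) * etaW a b x * (yx t x) ^ 2)
    (G := fun t x => -(2 * x * yx t x * yt t x) / sigW a b x
      + K / 2 * y t x * yt t x / sigW a b x)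
    (Gt := fun t x => -(2 * x * (ytx t x * yt t x + yx t x * ytt t x)) / sigW a b x
      + K / 2 * (yt t x * yt t x + y t x * ytt t x) / sigW a b x)
    (H := fun t x => x * (yt t x * yt t x * (etaW a b x * (a x)⁻¹))
      + x * etaW a b x * (yx t x * yx t x) - K / 2 * etaW a b x * y t x * yx t x)
    (Hx := fun t x => (1 - x * (a' x - b x) * (a x)⁻¹) * etaW a b x * (a x)⁻¹ * (yt t x * yt t x)
      + 2 * x * etaW a b x * (a x)⁻¹ * (yt t x * ytx t x)
      + etaW a b x * (1 + x * b x * (a x)⁻¹) * (yx t x * yx t x)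
      + 2 * x * etaW a b x * (yx t x * yxx t x)
      - K / 2 * (etaW a b x * b x * (a x)⁻¹ * y t x * yx t x + etaW a b x * (yx t x * yx t x)
        + etaW a b x * y t x * yxx t x))
    ((hF1.add hF2).congr_fun (fun _ _ => rfl) (measurableSet_Ioo.prod measurableSet_Ioo))
    ?_ ?_ ?_ (fun t ht => hy.integrableOn_slice hH1 (htpos t ht)) ?_ ?_ ?_ hφ hΦ ?_
  · have hsum : (∫ t in Ioo s T, ∫ x in Ioo (0:ℝ) 1,
          ((1 - x * (a' x - b x) / a x + K / 2) * (1 / sigW a b x) * (yt t x) ^ 2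
            + (1 - x * b x / a x - K / 2) * etaW a b x * (yx t x) ^ 2)) =
        (∫ t in Ioo s T, ∫ x in Ioo (0:ℝ) 1,
          (1 - x * (a' x - b x) / a x + K / 2) * (1 / sigW a b x) * (yt t x) ^ 2)
        + ∫ t in Ioo s T, ∫ x in Ioo (0:ℝ) 1,
          (1 - x * b x / a x - K / 2) * etaW a b x * (yx t x) ^ 2 :=
      integral_integral_add (integrable_prod_of_integrableOn le_rfl hF1)
        (integrable_prod_of_integrableOn le_rfl hF2)
    rw [← hsum, main]
    congr 1
    refine setIntegral_congr_fun measurableSet_Ioo fun t ht => ?_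
    simp only [sigW, div_eq_mul_inv, mul_inv, inv_inv]
    ring
  · intro t ht x hx
    have hax := hne x (hsub hx)
    have hηx := (hη x).ne'
    simp only [sigW, hy.pde t x (hs.trans ht.1) hx]
    field_simp
    ring
  · intro x hx t ht
    have ht0 := htpos t ht
    have h1 := (hy.dt t x ht0 ⟨hx.1.le, hx.2.le⟩)
    have h2 := (hy.dtt t x ht0 ⟨hx.1.le, hx.2.le⟩)
    have h3 := (hy.hasDerivWithinAt_yx hy.continuousOn_yt ht0 (hsub hx)).hasDerivAt
      (Ici_mem_nhds (hs.trans_le ht.1))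
    refine HasDerivAt.congr_deriv (HasDerivAt.fun_add
      (((h3.const_mul (2 * x)).fun_mul h2).fun_neg.div_const _)
      (((h1.const_mul (K / 2)).fun_mul h2).div_const _)) ?_
    ring
  · intro x hx
    have hx' := hsub hx
    have c1 := continuousOn_section_left (f := y) cy hx'
    have c2 := continuousOn_section_left (f := yt) cyt hx'
    have c3 := continuousOn_section_left (f := yx) cyx hx'
    have c4 := continuousOn_section_left (f := ytt) cytt hx'
    have c5 := continuousOn_section_left (f := ytx) cytx hx'
    simp only [div_eq_mul_inv]
    fun_prop
  · intro t ht x hx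
    have ht0 := htpos t ht
    have hax := hne x (hsub hx)
    have h1 := (hy.dx t x ht0 (hsub hx))
    have h2 := (hy.dtx t x ht0 (hsub hx))
    have h3 := (hy.dxx t x ht0 (hsub hx))
    have h4 := hasDerivAt_etaW hH1.2.2.1
      ((cb1.div ca1 hne).mono hsub) hx
    have h5 := (hd x hx).fun_inv hax
    refine HasDerivAt.congr_deriv (HasDerivAt.fun_sub (HasDerivAt.fun_add
      ((hasDerivAt_id' x).fun_mul ((h2.fun_mul h2).fun_mul (h4.fun_mul h5)))
      (((hasDerivAt_id' x).fun_mul h4).fun_mul (h3.fun_mul h3)))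
      (((h4.const_mul (K / 2)).fun_mul h1).fun_mul h3)) ?_
    field_simp
    ring
  · simp only [Function.uncurry_def]
    fun_prop
  · have k1 := lift (f := fun x => (1 - x * (a' x - b x) * (a x)⁻¹) * etaW a b x * (a x)⁻¹)
      (by fun_prop)
    have k2 := lift (f := fun x => 2 * x * etaW a b x * (a x)⁻¹) (by fun_prop)
    have k3 := lift (f := fun x => etaW a b x * (1 + x * b x * (a x)⁻¹)) (by fun_prop)
    have k4 := lift (f := fun x => 2 * x * etaW a b x) (by fun_prop)
    have k5 := lift (f := fun x => etaW a b x * b x * (a x)⁻¹) (by fun_prop)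
    exact ((((k1.mul (cyt.mul cyt)).add (k2.mul (cyt.mul cytx))).add
      (k3.mul (cyx.mul cyx))).add (k4.mul (cyx.mul cyxx))).sub
      (continuousOn_const.mul ((((k5.mul cy).mul cyx).add (cη.mul (cyx.mul cyx))).add
        ((cη.mul cy).mul cyxx)))
  · intro ε hε
    have hε' := hsub hε
    have hprodε := integrable_prod_of_integrableOn hε.2.le hP
    have c2 := continuousOn_section_left (f := yt) cyt hε'
    have c3 := continuousOn_section_left (f := yx) cyx hε'
    have hφε : IntegrableOn (fun t => ε * (2 * (yt t ε ^ 2 / sigW a b ε)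
        + 2 * (etaW a b ε * yx t ε ^ 2))) (Ioo s T) := by
      refine IntegrableOn.mono_set (ContinuousOn.integrableOn_Icc ?_) Ioo_subset_Icc_self
      simp only [div_eq_mul_inv]
      fun_prop
    have hΦε : IntegrableOn (fun t => C ^ 2 * ∫ x in Ioo 0 ε, etaW a b x * yx t x ^ 2)
        (Ioo s T) := hprodε.integral_prod_left.const_mul _
    rw [← integral_integral_swap (f := fun t x => etaW a b x * yx t x ^ 2) hprodε,
      ← integral_const_mul, ← integral_const_mul, ← integral_add hφε hΦε]
    refine (abs_integral_le_integral_abs).trans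
      (integral_mono_of_nonneg (Eventually.of_forall fun t => abs_nonneg _)
        (hφε.add hΦε) ?_)
    filter_upwards [ae_restrict_mem measurableSet_Ioo] with t ht
    have ht0 := htpos t (Ioo_subset_Icc_self ht)
    have hsl : IntegrableOn (fun x => etaW a b x * yx t x ^ 2) (Ioo 0 ε) := by
      have hsubε : Ioo 0 ε ⊆ Ioo (0:ℝ) 1 := Ioo_subset_Ioo le_rfl hε.2.le
      refine Integrable.bdd_mul (c := C) ((hy.regx t ht0).deriv_sq_int.mono_set hsubε)
        ((cη1.mono (hsubε.trans hsub)).aestronglyMeasurable measurableSet_Ioo) ?_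
      filter_upwards [ae_restrict_mem measurableSet_Ioo] with x hx
      rw [Real.norm_of_nonneg (hη x).le]
      exact hC x (Ioo_subset_Icc_self (hsubε hx))
    have hsq := hy.sq_le hC1 ht0 hε hsl
    have hfl := abs_flux_le (k := K / 2) (e := etaW a b ε) (E := yt t ε ^ 2 / sigW a b ε)
      (v := yx t ε) hε.1 (by linarith) (by linarith) (hη ε).le
      (hC ε (Ioo_subset_Icc_self hε))
      (div_nonneg (sq_nonneg _) (sigW_pos (hpos ε hε')).le)
      (integral_nonneg fun x => mul_nonneg (hη x).le (sq_nonneg _)) hsq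
    refine le_trans (le_of_eq ?_) hfl
    simp only [sigW, div_eq_mul_inv, mul_inv, inv_inv]
    ring_nf
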